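/- There is an absolute constant C > 0 with the following property. Let F be a finite field with q elements, let n ≥ 1, let a ∈ {1, −1}, and let m be an integer with 0 ≤ m ≤ n^{1/2}. Then the number of *-symmetric monic polynomials f of degree n over F with constant coefficient a that can be written as f = g·g*·h with g, h monic polynomials over F, g(0) ≠ 0, and deg h ≤ m, is at most C·N·(m+1)/n^{1/2}, where N is the total number of *-symmetric monic polynomials of degree n over F with constant coefficient a. -/

import Mathlib

open Polynomial

/-- `f` is *-symmetric: `f(0) ≠ 0` and `f* = f`, where `f*(X) = Xⁿ f(1/X)/f(0)`. -/
def IsStarSymm {F : Type} [Field F] (f : F[X]) : Prop :=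
  f.coeff 0 ≠ 0 ∧ f.reverse = Polynomial.C (f.coeff 0) * f

/-- The reciprocal `g*(X) = X^{deg g} g(1/X)/g(0)` of a polynomial with `g(0) ≠ 0`. -/
noncomputable def starRev {F : Type} [Field F] (g : F[X]) : F[X] :=
  Polynomial.C (g.coeff 0)⁻¹ * g.reverse

section Counting

variable {F : Type} [Field F]

theorem injOn_coeff_monic_natDegree (P : F[X] → Prop) (d : ℕ) :
    Set.InjOn (fun (g : F[X]) (i : Fin d) => g.coeff i)
      {g : F[X] | g.Monic ∧ g.natDegree = d ∧ P g} := by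
  rintro f ⟨hf, hfd, -⟩ g ⟨hg, hgd, -⟩ h
  ext i
  rcases lt_trichotomy i d with hi | rfl | hi
  · exact congrFun h ⟨i, hi⟩
  · rw [← hfd, hf.coeff_natDegree, hfd, ← hgd, hg.coeff_natDegree]
  · rw [coeff_eq_zero_of_natDegree_lt (by omega), coeff_eq_zero_of_natDegree_lt (by omega)]

theorem finite_monic_natDegree [Finite F] (P : F[X] → Prop) (d : ℕ) :
    {g : F[X] | g.Monic ∧ g.natDegree = d ∧ P g}.Finite :=
  Set.Finite.of_finite_image (Set.toFinite _) (injOn_coeff_monic_natDegree P d)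

/-- The monic polynomials of degree `d` over a finite field satisfying `P`. -/
noncomputable def monicFinset [Finite F] (P : F[X] → Prop) (d : ℕ) : Finset F[X] :=
  (finite_monic_natDegree P d).toFinset

@[simp]
theorem mem_monicFinset [Finite F] {P : F[X] → Prop} {d : ℕ} {g : F[X]} :
    g ∈ monicFinset P d ↔ g.Monic ∧ g.natDegree = d ∧ P g := by
  simp [monicFinset]

theorem card_monicFinset_le [Fintype F] (P : F[X] → Prop) (d : ℕ) :
    (monicFinset P d).card ≤ Fintype.card F ^ d := by
  classical
  calc (monicFinset P d).card ≤ (Finset.univ : Finset (Fin d → F)).card := by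
        refine Finset.card_le_card_of_injOn (fun g i => g.coeff i) (by simp) ?_
        simpa [monicFinset] using injOn_coeff_monic_natDegree P d
    _ = Fintype.card F ^ d := by simp

theorem isStarSymm_iff_coeff {f : F[X]} (h0 : f.coeff 0 ≠ 0) :
    IsStarSymm f ↔
      ∀ i j, i + j = f.natDegree → f.coeff i = f.coeff 0 * f.coeff j := by
  refine ⟨fun h i j hij => ?_, fun h => ⟨h0, ?_⟩⟩
  · have := congrArg (fun p => p.coeff j) h.2
    simp only [coeff_reverse, coeff_C_mul] at this
    rwa [revAt_le (by omega), show f.natDegree - j = i by omega] at this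
  · ext i
    rw [coeff_reverse, coeff_C_mul]
    rcases le_or_gt i f.natDegree with hi | hi
    · rw [revAt_le hi]
      exact h _ _ (by omega)
    · rw [revAt_eq_self_of_lt hi, coeff_eq_zero_of_natDegree_lt hi, mul_zero]

theorem card_starSymm_le [Fintype F] (a : F) (d : ℕ) :
    (monicFinset (fun f : F[X] => IsStarSymm f ∧ f.coeff 0 = a) d).card ≤
      Fintype.card F ^ (d / 2) := by
  classical
  calc _ ≤ (Finset.univ : Finset (Fin (d / 2) → F)).card := by
        refine Finset.card_le_card_of_injOn (fun g i => g.coeff (i + 1)) (by simp) ?_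
        intro f hf g hg h
        simp only [Finset.mem_coe, mem_monicFinset] at hf hg
        obtain ⟨-, hfd, hfs, hfa⟩ := hf
        obtain ⟨-, hgd, hgs, hga⟩ := hg
        have hlow : ∀ i ≤ d / 2, f.coeff i = g.coeff i := by
          rintro (_ | i) hi
          · rw [hfa, hga]
          · exact congrFun h ⟨i, by omega⟩
        ext i
        rcases le_or_gt i (d / 2) with hi | hi
        · exact hlow i hi
        · rcases le_or_gt i d with hi' | hi'
          · rw [(isStarSymm_iff_coeff hfs.1).1 hfs i (d - i) (by omega),
              (isStarSymm_iff_coeff hgs.1).1 hgs i (d - i) (by omega), hfa, hga,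
              hlow _ (by omega)]
          · rw [coeff_eq_zero_of_natDegree_lt (by omega),
              coeff_eq_zero_of_natDegree_lt (by omega)]
    _ = Fintype.card F ^ (d / 2) := by simp

theorem IsStarSymm.coeff_zero_eq {f : F[X]} (hm : f.Monic) (hf : IsStarSymm f) :
    f.coeff 0 = 1 ∨ f.coeff 0 = -1 := by
  have h := (isStarSymm_iff_coeff hf.1).1 hf f.natDegree 0 (by simp)
  rw [hm.coeff_natDegree] at h
  exact mul_self_eq_one_iff.1 h.symm

theorem card_isStarSymm_le [Fintype F] (d : ℕ) :
    (monicFinset (IsStarSymm (F := F)) d).card ≤ 2 * Fintype.card F ^ (d / 2) := by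
  classical
  calc _ ≤ (monicFinset (fun f : F[X] => IsStarSymm f ∧ f.coeff 0 = 1) d ∪
        monicFinset (fun f : F[X] => IsStarSymm f ∧ f.coeff 0 = -1) d).card := by
        refine Finset.card_le_card fun f hf => ?_
        simp only [mem_monicFinset, Finset.mem_union] at hf ⊢
        have := hf.2.2.coeff_zero_eq hf.1
        tauto
    _ ≤ _ := (Finset.card_union_le _ _).trans <| by
        rw [two_mul]
        exact add_le_add (card_starSymm_le _ _) (card_starSymm_le _ _)

theorem card_starSymm_mul_le [Fintype F] {a : F} (ha : a * a = 1) (n : ℕ) :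
    (monicFinset (fun f : F[X] => IsStarSymm f ∧ f.coeff 0 = a) n).card * Fintype.card F ≤
      (monicFinset (fun f : F[X] => IsStarSymm f ∧ f.coeff 0 = a) (n + 2)).card := by
  classical
  have ha0 : a ≠ 0 := by rintro rfl; simp at ha
  let B : F[X] := if n = 0 then 1 else X ^ n + C a
  have hBn : B.coeff n = 1 := by
    by_cases hn : n = 0
    · simp [B, hn]
    · simp [B, hn, coeff_C]
  have hB : ∀ i, n < i → B.coeff i = 0 := by
    intro i hi
    by_cases hn : n = 0
    · simp [B, hn, coeff_one, show i ≠ 0 by omega]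
    · simp [B, hn, coeff_C, coeff_X_pow, show i ≠ 0 by omega, show i ≠ n by omega]
  have hBs : (n = 0 → a = 1) → ∀ i j, i + j = n → B.coeff i = a * B.coeff j := by
    intro h i j hij
    by_cases hn : n = 0
    · obtain ⟨rfl, rfl⟩ : i = 0 ∧ j = 0 := by omega
      simp [B, hn, h hn]
    · rcases Nat.eq_zero_or_pos i with rfl | hi
      · simp [B, hn, coeff_C, coeff_X_pow, show j = n by omega, Ne.symm hn]
      · rcases Nat.eq_zero_or_pos j with rfl | hj
        · simp [B, hn, coeff_C, coeff_X_pow, show i = n by omega, Ne.symm hn, ha]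
        · simp [B, hn, coeff_C, coeff_X_pow, show i ≠ n by omega, show j ≠ n by omega,
            show i ≠ 0 by omega, show j ≠ 0 by omega]
  rw [← Finset.card_univ, ← Finset.card_product]
  refine Finset.card_le_card_of_injOn
    (fun x => X ^ (n + 2) + C a + X * (x.1 + C (x.2 - 1) * B)) ?_ ?_
  · rintro ⟨h, c⟩ hx
    simp only [Finset.coe_product, Finset.coe_univ, Set.mem_prod, Finset.mem_coe, mem_monicFinset,
      Set.mem_univ, and_true] at hx ⊢
    obtain ⟨hm, hd, hs, h0⟩ := hx
    set w : F[X] := h + C (c - 1) * B with hw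
    have hwn : ∀ i, n < i → w.coeff i = 0 := by
      intro i hi
      rw [hw, coeff_add, coeff_C_mul, hB i hi,
        coeff_eq_zero_of_natDegree_lt (show h.natDegree < i by omega), mul_zero, add_zero]
    have hws : ∀ i j, i + j = n → w.coeff i = a * w.coeff j := by
      intro i j hij
      have hn : n = 0 → a = 1 := by
        rintro rfl
        rw [← h0, ← hm.coeff_natDegree, hd]
      simp only [hw, coeff_add, coeff_C_mul, hBs hn i j hij,
        (isStarSymm_iff_coeff hs.1).1 hs i j (by omega), h0]
      ring
    set f : F[X] := X ^ (n + 2) + C a + X * w with hf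
    have hf0 : f.coeff 0 = a := by simp [hf, coeff_X_pow]
    have hfs : ∀ i, f.coeff (i + 1) = (if i = n + 1 then 1 else 0) + w.coeff i := by
      intro i
      simp [hf, coeff_X_pow]
    have hft : f.coeff (n + 2) = 1 := by
      rw [hfs, hwn _ (by omega)]; simp
    have hfd : f.natDegree = n + 2 := by
      refine natDegree_eq_of_le_of_coeff_ne_zero ?_ (by rw [hft]; exact one_ne_zero)
      refine natDegree_le_iff_coeff_eq_zero.2 fun i hi => ?_
      obtain ⟨i, rfl⟩ : ∃ k, i = k + 1 := ⟨i - 1, by omega⟩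
      rw [hfs, hwn _ (by omega), if_neg (by omega), add_zero]
    refine ⟨by rw [Monic, leadingCoeff, hfd, hft], hfd, ?_, hf0⟩
    rw [isStarSymm_iff_coeff (by rwa [hf0]), hf0, hfd]
    rintro (_ | i) (_ | j) hij
    · omega
    · rw [hf0, show j + 1 = n + 2 by omega, hft, mul_one]
    · rw [hf0, show i + 1 = n + 2 by omega, hft, ha]
    · rw [hfs, hfs, if_neg (by omega), if_neg (by omega), zero_add, zero_add]
      exact hws i j (by omega)
  · rintro ⟨h, c⟩ hx ⟨h', c'⟩ hx' heq
    simp only [Finset.coe_product, Finset.coe_univ, Set.mem_prod, Finset.mem_coe, mem_monicFinset,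
      Set.mem_univ, and_true] at hx hx'
    have hw : h + C (c - 1) * B = h' + C (c' - 1) * B :=
      mul_left_cancel₀ X_ne_zero (add_left_cancel heq)
    have hc : c = c' := by
      have := congrArg (fun p => p.coeff n) hw
      simp only [coeff_add, coeff_C_mul, hBn, mul_one] at this
      rw [← hx.2.1, hx.1.coeff_natDegree, hx.2.1, ← hx'.2.1, hx'.1.coeff_natDegree] at this
      simpa using this
    subst hc
    rw [add_right_cancel hw]

theorem card_starSymm_mul_pow_le [Fintype F] {a : F} (ha : a * a = 1) (j d : ℕ) :
    (monicFinset (fun f : F[X] => IsStarSymm f ∧ f.coeff 0 = a) j).card * Fintype.card F ^ d ≤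
      (monicFinset (fun f : F[X] => IsStarSymm f ∧ f.coeff 0 = a) (j + 2 * d)).card := by
  induction d with
  | zero => simp
  | succ d ih =>
    rw [pow_succ, ← mul_assoc]
    exact (Nat.mul_le_mul_right _ ih).trans (card_starSymm_mul_le ha _)

theorem reverse_reverse_of_coeff_zero_ne {g : F[X]} (h : g.coeff 0 ≠ 0) :
    g.reverse.reverse = g := by
  have hd : g.reverse.natDegree = g.natDegree := by
    rw [reverse_natDegree, natTrailingDegree_eq_zero.2 (Or.inr h), Nat.sub_zero]
  rw [reverse, hd, reverse, reflect_reflect]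

theorem starRev_mul (g h : F[X]) : starRev (g * h) = starRev g * starRev h := by
  simp only [starRev, reverse_mul_of_domain, mul_coeff_zero, mul_inv, C_mul]
  ring

theorem starRev_one : starRev (1 : F[X]) = 1 := by
  rw [starRev, ← C_1, reverse_C]
  simp

theorem natDegree_starRev {g : F[X]} (h : g.coeff 0 ≠ 0) :
    (starRev g).natDegree = g.natDegree := by
  rw [starRev, natDegree_C_mul (inv_ne_zero h), reverse_natDegree,
    natTrailingDegree_eq_zero.2 (Or.inr h), Nat.sub_zero]

theorem monic_starRev {g : F[X]} (h : g.coeff 0 ≠ 0) : (starRev g).Monic := by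
  rw [Monic, starRev, leadingCoeff_mul, leadingCoeff_C, reverse_leadingCoeff, trailingCoeff,
    natTrailingDegree_eq_zero.2 (Or.inr h), inv_mul_cancel₀ h]

theorem coeff_zero_starRev {g : F[X]} (hg : g.Monic) :
    (starRev g).coeff 0 = (g.coeff 0)⁻¹ := by
  rw [starRev, coeff_C_mul, coeff_zero_reverse, hg.leadingCoeff, mul_one]

theorem coeff_zero_starRev_ne {g : F[X]} (hg : g.Monic) (h : g.coeff 0 ≠ 0) :
    (starRev g).coeff 0 ≠ 0 := by
  rw [coeff_zero_starRev hg]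
  exact inv_ne_zero h

theorem starRev_starRev {g : F[X]} (hg : g.Monic) (h : g.coeff 0 ≠ 0) :
    starRev (starRev g) = g := by
  rw [starRev, coeff_zero_starRev hg, inv_inv, starRev, reverse_mul_of_domain, reverse_C,
    reverse_reverse_of_coeff_zero_ne h, ← mul_assoc, ← C_mul, mul_inv_cancel₀ h, C_1, one_mul]

theorem irreducible_starRev {p : F[X]} (hm : p.Monic) (h : p.coeff 0 ≠ 0) (hp : Irreducible p) :
    Irreducible (starRev p) := by
  have hunit : ∀ {a : F[X]}, a.coeff 0 ≠ 0 → IsUnit (starRev a) → IsUnit a := by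
    intro a ha hu
    have ha' : a ≠ 0 := by rintro rfl; simp at ha
    refine isUnit_iff_degree_eq_zero.2 ?_
    rw [degree_eq_natDegree ha', ← natDegree_starRev ha, natDegree_eq_zero_of_isUnit hu]
    rfl
  refine ⟨fun hu => hp.not_isUnit (hunit h hu), fun a b hab => ?_⟩
  have h0 := coeff_zero_starRev_ne hm h
  rw [hab, mul_coeff_zero] at h0
  have hp' : p = starRev a * starRev b := by
    rw [← starRev_mul, ← hab, starRev_starRev hm h]
  exact (hp.isUnit_or_isUnit hp').imp (hunit (left_ne_zero_of_mul h0))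
    (hunit (right_ne_zero_of_mul h0))

theorem isStarSymm_iff_starRev {f : F[X]} (h0 : f.coeff 0 ≠ 0) :
    IsStarSymm f ↔ starRev f = f := by
  have hc : (C (f.coeff 0)⁻¹ : F[X]) * C (f.coeff 0) = 1 := by
    rw [← C_mul, inv_mul_cancel₀ h0, C_1]
  refine ⟨fun h => ?_, fun h => ⟨h0, ?_⟩⟩
  · rw [starRev, h.2, ← mul_assoc, hc, one_mul]
  · conv_rhs => enter [2]; rw [← h, starRev]
    rw [← mul_assoc, ← C_mul, mul_inv_cancel₀ h0, C_1, one_mul]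

theorem IsStarSymm.mul {f g : F[X]} (hf : IsStarSymm f) (hg : IsStarSymm g) :
    IsStarSymm (f * g) := by
  refine (isStarSymm_iff_starRev ?_).2 ?_
  · rw [mul_coeff_zero]
    exact mul_ne_zero hf.1 hg.1
  · rw [starRev_mul, (isStarSymm_iff_starRev hf.1).1 hf, (isStarSymm_iff_starRev hg.1).1 hg]

theorem isStarSymm_of_mul_starRev {g h : F[X]} (hg : g.Monic) (h0 : g.coeff 0 ≠ 0)
    (hf : IsStarSymm (g * starRev g * h)) : IsStarSymm h := by
  have hh : h.coeff 0 ≠ 0 := by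
    have := hf.1
    rw [mul_coeff_zero] at this
    exact right_ne_zero_of_mul this
  have hne : g * starRev g ≠ 0 := (hg.mul (monic_starRev h0)).ne_zero
  have := (isStarSymm_iff_starRev hf.1).1 hf
  rw [starRev_mul, starRev_mul, starRev_starRev hg h0, mul_comm (starRev g)] at this
  exact (isStarSymm_iff_starRev hh).2 (mul_left_cancel₀ hne this)

/-- Every monic irreducible factor of `g` satisfies `R`. -/
def FactorsIn (R : F[X] → Prop) (g : F[X]) : Prop :=
  ∀ p : F[X], p.Monic → Irreducible p → p ∣ g → R p

@[elab_as_elim]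
theorem monic_induction {P : (g : F[X]) → g.Monic → Prop} (one : P 1 monic_one)
    (mul : ∀ (p g : F[X]) (hpm : p.Monic) (_ : Irreducible p) (hg : g.Monic),
      P g hg → P (p * g) (hpm.mul hg))
    (g : F[X]) (hg : g.Monic) : P g hg := by
  induction hn : g.natDegree using Nat.strong_induction_on generalizing g with
  | _ n ih =>
    by_cases hu : IsUnit g
    · obtain rfl := hg.eq_one_of_isUnit hu
      exact one
    · obtain ⟨p, hpm, hp, g', rfl⟩ := exists_monic_irreducible_factor g hu
      have hg' : g'.Monic := hpm.of_mul_monic_left hg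
      refine mul p g' hpm hp hg' (ih _ ?_ g' hg' rfl)
      rw [hpm.natDegree_mul hg'] at hn
      have := hp.natDegree_pos
      omega

theorem FactorsIn.of_dvd {R : F[X] → Prop} {g h : F[X]} (hg : FactorsIn R g) (hd : h ∣ g) :
    FactorsIn R h :=
  fun p hm hp hph => hg p hm hp (hph.trans hd)

theorem factorsIn_one (R : F[X] → Prop) : FactorsIn R 1 :=
  fun _ _ hp hd => (hp.not_isUnit (isUnit_of_dvd_one hd)).elim

theorem FactorsIn.irreducible_mul {R : F[X] → Prop} {p g : F[X]} (hm : p.Monic)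
    (hp : Irreducible p) (hR : R p) (hg : FactorsIn R g) : FactorsIn R (p * g) := by
  intro r hrm hr hd
  rcases hr.prime.dvd_or_dvd hd with h | h
  · rwa [eq_of_monic_of_associated hrm hm (hr.associated_of_dvd hp h)]
  · exact hg r hrm hr h

theorem FactorsIn.isCoprime {R : F[X] → Prop} {g h : F[X]} (hg : FactorsIn R g) (hg0 : g.Monic)
    (hh : FactorsIn (fun p => ¬ R p) h) : IsCoprime g h := by
  refine EuclideanDomain.isCoprime_of_dvd (fun h0 => hg0.ne_zero h0.1) fun z hz _ hzg hzh => ?_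
  obtain ⟨p, hpm, hp, hpz⟩ := exists_monic_irreducible_factor z hz
  exact hh p hpm hp (hpz.trans hzh) (hg p hpm hp (hpz.trans hzg))

theorem factorsIn_mul_injOn {R : F[X] → Prop} {g h g' h' : F[X]} (hg : g.Monic) (hg' : g'.Monic)
    (hgR : FactorsIn R g) (hgR' : FactorsIn R g') (hh : FactorsIn (fun p => ¬ R p) h)
    (hh' : FactorsIn (fun p => ¬ R p) h') (heq : g * h = g' * h') : g = g' ∧ h = h' := by
  have h1 : g ∣ g' := (hgR.isCoprime hg hh').dvd_of_dvd_mul_right (heq ▸ dvd_mul_right g h)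
  have h2 : g' ∣ g := (hgR'.isCoprime hg' hh).dvd_of_dvd_mul_right (heq ▸ dvd_mul_right g' h')
  have h3 : g = g' := eq_of_monic_of_associated hg hg' (associated_of_dvd_dvd h1 h2)
  subst h3
  exact ⟨rfl, mul_left_cancel₀ hg.ne_zero heq⟩

open Finset.HasAntidiagonal in
theorem sum_card_factorsIn_le [Fintype F] (R : F[X] → Prop) (k : ℕ) :
    ∑ x ∈ antidiagonal k, (monicFinset (FactorsIn R) x.1).card *
        (monicFinset (FactorsIn fun p => ¬ R p) x.2).card ≤ Fintype.card F ^ k := by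
  classical
  calc _ = ((antidiagonal k).sigma fun x =>
        monicFinset (FactorsIn R) x.1 ×ˢ monicFinset (FactorsIn fun p => ¬ R p) x.2).card := by
        rw [Finset.card_sigma]
        exact Finset.sum_congr rfl fun x _ => (Finset.card_product _ _).symm
    _ ≤ (monicFinset (fun _ : F[X] => True) k).card := by
        refine Finset.card_le_card_of_injOn (fun x => x.2.1 * x.2.2) ?_ ?_
        · rintro ⟨⟨i, j⟩, g, h⟩ hx
          simp only [Finset.coe_sigma, Set.mem_sigma_iff, Finset.mem_coe, mem_antidiagonal,
            Finset.mem_product, mem_monicFinset, and_true] at hx ⊢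
          obtain ⟨hij, ⟨hg, hgi, -⟩, hh, hhj, -⟩ := hx
          exact ⟨hg.mul hh, by rw [hg.natDegree_mul hh]; omega⟩
        · rintro ⟨⟨i, j⟩, g, h⟩ hx ⟨⟨i', j'⟩, g', h'⟩ hx' heq
          simp only [Finset.coe_sigma, Set.mem_sigma_iff, Finset.mem_coe, mem_antidiagonal,
            Finset.mem_product, mem_monicFinset] at hx hx'
          obtain ⟨hij, ⟨hg, rfl, hgR⟩, hh, rfl, hhR⟩ := hx
          obtain ⟨hij', ⟨hg', rfl, hgR'⟩, hh', rfl, hhR'⟩ := hx'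
          obtain ⟨rfl, rfl⟩ := factorsIn_mul_injOn hg hg' hgR hgR' hhR hhR' heq
          rfl
    _ ≤ _ := card_monicFinset_le _ _

/-- A choice of one element in each pair `{p, p*}` of reciprocal polynomials with nonzero constant
coefficient. -/
def IsStarRep (p : F[X]) : Prop :=
  p.coeff 0 ≠ 0 ∧ ¬ WellOrderingRel (starRev p) p

theorem isStarRep_or_starRev {p : F[X]} (hm : p.Monic) (h : p.coeff 0 ≠ 0) :
    IsStarRep p ∨ IsStarRep (starRev p) := by
  by_contra! hc
  have h1 : WellOrderingRel (starRev p) p := by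
    by_contra h'
    exact hc.1 ⟨h, h'⟩
  have h2 : WellOrderingRel p (starRev p) := by
    by_contra h'
    exact hc.2 ⟨coeff_zero_starRev_ne hm h, by rwa [starRev_starRev hm h]⟩
  exact asymm_of WellOrderingRel h1 h2

theorem not_isStarRep_starRev {p : F[X]} (hm : p.Monic) (hp : IsStarRep p) (hne : starRev p ≠ p) :
    ¬ IsStarRep (starRev p) := by
  rintro ⟨-, h⟩
  rw [starRev_starRev hm hp.1] at h
  exact hne (((trichotomous_of WellOrderingRel (starRev p) p).resolve_left hp.2).resolve_right h)

theorem exists_factorsIn_isStarRep (g : F[X]) (hg : g.Monic) (h0 : g.coeff 0 ≠ 0) :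
    ∃ r : F[X], r.Monic ∧ r.natDegree = g.natDegree ∧ FactorsIn IsStarRep r ∧
      g * starRev g = r * starRev r := by
  induction g, hg using monic_induction with
  | one => exact ⟨1, monic_one, rfl, factorsIn_one _, rfl⟩
  | mul p g hpm hp hg ih =>
    rw [mul_coeff_zero] at h0
    have hp0 := left_ne_zero_of_mul h0
    obtain ⟨r, hr, hrd, hrR, hrg⟩ := ih (right_ne_zero_of_mul h0)
    rcases isStarRep_or_starRev hpm hp0 with h | h
    · refine ⟨p * r, hpm.mul hr, by rw [hpm.natDegree_mul hr, hpm.natDegree_mul hg, hrd],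
        hrR.irreducible_mul hpm hp h, ?_⟩
      rw [starRev_mul, starRev_mul]
      linear_combination p * starRev p * hrg
    · have hpm' := monic_starRev hp0
      refine ⟨starRev p * r, hpm'.mul hr, ?_,
        hrR.irreducible_mul hpm' (irreducible_starRev hpm hp0 hp) h, ?_⟩
      · rw [hpm'.natDegree_mul hr, hpm.natDegree_mul hg, hrd, natDegree_starRev hp0]
      · rw [starRev_mul, starRev_mul, starRev_starRev hpm hp0]
        linear_combination p * starRev p * hrg

theorem exists_isStarSymm_mul_starRev (g : F[X]) (hg : g.Monic) (hR : FactorsIn IsStarRep g) :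
    ∃ s t : F[X], s.Monic ∧ IsStarSymm s ∧ t.Monic ∧ FactorsIn (fun p => ¬ IsStarRep p) t ∧
      t.coeff 0 ≠ 0 ∧ g = s * starRev t := by
  induction g, hg using monic_induction with
  | one =>
    refine ⟨1, 1, monic_one, (isStarSymm_iff_starRev (by simp)).2 starRev_one, monic_one,
      factorsIn_one _, by simp, by rw [starRev_one, one_mul]⟩
  | mul p g hpm hp hg ih =>
    obtain ⟨s, t, hs, hss, ht, htR, ht0, rfl⟩ := ih (hR.of_dvd (dvd_mul_left _ _))
    have hpR : IsStarRep p := hR p hpm hp (dvd_mul_right _ _)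
    by_cases hpp : starRev p = p
    · exact ⟨p * s, t, hpm.mul hs, ((isStarSymm_iff_starRev hpR.1).2 hpp).mul hss, ht, htR, ht0,
        by ring⟩
    · refine ⟨s, starRev p * t, hs, hss, (monic_starRev hpR.1).mul ht,
        htR.irreducible_mul (monic_starRev hpR.1) (irreducible_starRev hpm hpR.1 hp)
          (not_isStarRep_starRev hpm hpR hpp), ?_, ?_⟩
      · rw [mul_coeff_zero]
        exact mul_ne_zero (coeff_zero_starRev_ne hpm hpR.1) ht0
      · rw [starRev_mul, starRev_starRev hpm hpR.1]
        ring

open Finset.HasAntidiagonal in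
theorem card_factorsIn_isStarRep_le [Fintype F] (k : ℕ) :
    (monicFinset (FactorsIn (IsStarRep (F := F))) k).card ≤
      ∑ x ∈ antidiagonal k, (monicFinset (IsStarSymm (F := F)) x.1).card *
        (monicFinset (FactorsIn fun p : F[X] => ¬ IsStarRep p) x.2).card := by
  classical
  calc _ ≤ ((antidiagonal k).biUnion fun x => (monicFinset (IsStarSymm (F := F)) x.1 ×ˢ
        monicFinset (FactorsIn fun p : F[X] => ¬ IsStarRep p) x.2).image
          fun y => y.1 * starRev y.2).card := by
        refine Finset.card_le_card fun g hg => ?_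
        obtain ⟨hg, hgk, hR⟩ := mem_monicFinset.1 hg
        obtain ⟨s, t, hs, hss, ht, htR, ht0, rfl⟩ := exists_isStarSymm_mul_starRev g hg hR
        rw [hs.natDegree_mul (monic_starRev ht0), natDegree_starRev ht0] at hgk
        refine Finset.mem_biUnion.2 ⟨(s.natDegree, t.natDegree),
          mem_antidiagonal.2 hgk, Finset.mem_image.2 ⟨(s, t), ?_, rfl⟩⟩
        simp [hs, hss, ht, htR]
    _ ≤ _ := Finset.card_biUnion_le.trans <| Finset.sum_le_sum fun x _ =>
        Finset.card_image_le.trans (Finset.card_product _ _).le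

theorem sum_natDegree_irreducible_le [Fintype F] {k : ℕ} (hk : k ≠ 0) (s : Finset F[X])
    (hs : ∀ p ∈ s, p.Monic ∧ Irreducible p ∧ p.natDegree ∣ k) :
    ∑ p ∈ s, p.natDegree ≤ Fintype.card F ^ k := by
  have hq : 1 < Fintype.card F := Fintype.one_lt_card
  have hdvd : ∏ p ∈ s, p ∣ X ^ Fintype.card F ^ k - X := by
    refine Finset.prod_dvd_of_coprime ?_ ?_
    · intro p hp r hr hne
      refine (hs p hp).2.1.coprime_iff_not_dvd.2 fun h => hne ?_
      exact eq_of_monic_of_associated (hs p hp).1 (hs r hr).1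
        ((hs p hp).2.1.associated_of_dvd (hs r hr).2.1 h)
    · intro p hp
      rw [Fintype.card_eq_nat_card]
      exact (hs p hp).2.1.natDegree_dvd_iff_dvd_X_pow_card_pow_sub_X.1 (hs p hp).2.2
  rw [← natDegree_prod_of_monic _ _ fun p hp => (hs p hp).1,
    ← FiniteField.X_pow_card_pow_sub_X_natDegree_eq F hk hq]
  exact natDegree_le_of_dvd hdvd (FiniteField.X_pow_card_pow_sub_X_ne_zero F hk hq)

open UniqueFactorizationMonoid in
theorem natDegree_le_sum_card_pow_dvd [DecidableRel ((· ∣ ·) : F[X] → F[X] → Prop)]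
    {g : F[X]} (hg : g.Monic) (s : Finset F[X])
    (hs : ∀ p : F[X], p.Monic → Irreducible p → p ∣ g → p ∈ s) :
    g.natDegree ≤ ∑ p ∈ s, p.natDegree * {e ∈ Finset.Icc 1 g.natDegree | p ^ e ∣ g}.card := by
  classical
  have hprod : (normalizedFactors g).prod = g := by
    rw [prod_normalizedFactors_eq hg.ne_zero, hg.normalize_eq_self]
  have hfac : ∀ p ∈ normalizedFactors g, p.Monic ∧ Irreducible p := by
    intro p hp
    have hi := irreducible_of_normalized_factor p hp
    rw [← normalize_normalized_factor p hp]
    exact ⟨monic_normalize hi.ne_zero, by rwa [normalize_normalized_factor p hp]⟩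
  calc g.natDegree = ((normalizedFactors g).map natDegree).sum := by
        conv_lhs => rw [← hprod]
        exact natDegree_multiset_prod_of_monic _ fun p hp => (hfac p hp).1
    _ = ∑ p ∈ (normalizedFactors g).toFinset, (normalizedFactors g).count p * p.natDegree := by
        simp [Finset.sum_multiset_map_count]
    _ ≤ ∑ p ∈ (normalizedFactors g).toFinset,
          p.natDegree * {e ∈ Finset.Icc 1 g.natDegree | p ^ e ∣ g}.card := by
        refine Finset.sum_le_sum fun p hp => ?_
        rw [mul_comm]
        have hp' := hfac p (Multiset.mem_toFinset.1 hp)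
        refine Nat.mul_le_mul_left _ ?_
        calc (normalizedFactors g).count p
            = (Finset.Icc 1 ((normalizedFactors g).count p)).card := by simp
          _ ≤ _ := by
            refine Finset.card_le_card fun e he => ?_
            rw [Finset.mem_Icc] at he
            have hd : p ^ e ∣ g := by
              rw [pow_dvd_iff_le_emultiplicity,
                emultiplicity_eq_count_normalizedFactors hp'.2 hg.ne_zero, hp'.1.normalize_eq_self]
              exact_mod_cast he.2
            have := natDegree_le_of_dvd hd hg.ne_zero
            rw [hp'.1.natDegree_pow] at this
            have := Nat.le_mul_of_pos_right e hp'.2.natDegree_pos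
            simp only [Finset.mem_filter, Finset.mem_Icc]
            exact ⟨⟨he.1, by omega⟩, hd⟩
    _ ≤ _ := Finset.sum_le_sum_of_subset fun p hp =>
        have hp := Multiset.mem_toFinset.1 hp
        hs p (hfac p hp).1 (hfac p hp).2 (dvd_of_mem_normalizedFactors hp)

theorem card_factorsIn_pow_dvd_le [Finite F] [DecidableRel ((· ∣ ·) : F[X] → F[X] → Prop)]
    (R : F[X] → Prop) {p : F[X]} (hp : p.Monic) (d e : ℕ) :
    {g ∈ monicFinset (FactorsIn R) d | p ^ e ∣ g}.card ≤
      if e * p.natDegree ≤ d then (monicFinset (FactorsIn R) (d - e * p.natDegree)).card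
      else 0 := by
  classical
  split_ifs with hed
  · refine (Finset.card_le_card fun g hg => ?_).trans
      (Finset.card_image_le (f := fun h => p ^ e * h))
    rw [Finset.mem_filter, mem_monicFinset] at hg
    obtain ⟨⟨hg, hgd, hR⟩, h, rfl⟩ := hg
    have hpe : (p ^ e).Monic := hp.pow e
    have hh : h.Monic := hpe.of_mul_monic_left hg
    rw [hpe.natDegree_mul hh, hp.natDegree_pow] at hgd
    exact Finset.mem_image.2 ⟨h, mem_monicFinset.2
      ⟨hh, by omega, hR.of_dvd (dvd_mul_left _ _)⟩, rfl⟩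
  · rw [Nat.le_zero, Finset.card_eq_zero, Finset.filter_eq_empty_iff]
    intro g hg hd
    rw [mem_monicFinset] at hg
    have := natDegree_le_of_dvd hd hg.1.ne_zero
    rw [hp.natDegree_pow] at this
    omega

theorem mul_card_factorsIn_le [Fintype F] (R : F[X] → Prop) (d : ℕ) :
    d * (monicFinset (FactorsIn R) d).card ≤ ∑ k ∈ Finset.Icc 1 d,
      Fintype.card F ^ k * (monicFinset (FactorsIn R) (d - k)).card := by
  classical
  let s : Finset F[X] := (Finset.Icc 1 d).biUnion (monicFinset Irreducible)
  let t : Finset (F[X] × ℕ) := {x ∈ s ×ˢ Finset.Icc 1 d | x.2 * x.1.natDegree ≤ d}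
  have hs : ∀ p ∈ s, p.Monic ∧ Irreducible p := by
    intro p hp
    obtain ⟨i, -, hi⟩ := Finset.mem_biUnion.1 hp
    rw [mem_monicFinset] at hi
    exact ⟨hi.1, hi.2.2⟩
  have ht : ∀ x ∈ t, x.1 ∈ s ∧ 1 ≤ x.2 ∧ x.2 * x.1.natDegree ≤ d := by
    intro x hx
    simp only [t, Finset.mem_filter, Finset.mem_product, Finset.mem_Icc] at hx
    exact ⟨hx.1.1, hx.1.2.1, hx.2⟩
  calc d * (monicFinset (FactorsIn R) d).card = ∑ g ∈ monicFinset (FactorsIn R) d, d := by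
        rw [Finset.sum_const, smul_eq_mul, mul_comm]
    _ ≤ ∑ g ∈ monicFinset (FactorsIn R) d, ∑ x ∈ s ×ˢ Finset.Icc 1 d,
          if x.1 ^ x.2 ∣ g then x.1.natDegree else 0 := by
        refine Finset.sum_le_sum fun g hg => ?_
        obtain ⟨hg, hgd, -⟩ := mem_monicFinset.1 hg
        rw [Finset.sum_product]
        calc d = g.natDegree := hgd.symm
          _ ≤ _ := natDegree_le_sum_card_pow_dvd hg s fun p hpm hp hpg =>
            Finset.mem_biUnion.2 ⟨p.natDegree, Finset.mem_Icc.2 ⟨hp.natDegree_pos,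
              hgd ▸ natDegree_le_of_dvd hpg hg.ne_zero⟩, mem_monicFinset.2 ⟨hpm, rfl, hp⟩⟩
          _ = _ := by
            refine Finset.sum_congr rfl fun p _ => ?_
            simp only [← Finset.sum_filter, Finset.sum_const, smul_eq_mul, mul_comm, hgd]
    _ = ∑ x ∈ s ×ˢ Finset.Icc 1 d,
          x.1.natDegree * {g ∈ monicFinset (FactorsIn R) d | x.1 ^ x.2 ∣ g}.card := by
        rw [Finset.sum_comm]
        refine Finset.sum_congr rfl fun x _ => ?_
        rw [← Finset.sum_filter, Finset.sum_const, smul_eq_mul, mul_comm]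
    _ ≤ ∑ x ∈ s ×ˢ Finset.Icc 1 d, if x.2 * x.1.natDegree ≤ d then
          x.1.natDegree * (monicFinset (FactorsIn R) (d - x.2 * x.1.natDegree)).card else 0 := by
        refine Finset.sum_le_sum fun x hx => ?_
        rw [← mul_ite_zero]
        exact Nat.mul_le_mul_left _
          (card_factorsIn_pow_dvd_le R (hs x.1 (Finset.mem_product.1 hx).1).1 d x.2)
    _ = ∑ x ∈ t, x.1.natDegree *
          (monicFinset (FactorsIn R) (d - x.2 * x.1.natDegree)).card := by
        rw [Finset.sum_filter]
    _ = ∑ k ∈ Finset.Icc 1 d, ∑ x ∈ t with x.2 * x.1.natDegree = k,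
          x.1.natDegree * (monicFinset (FactorsIn R) (d - x.2 * x.1.natDegree)).card := by
        refine (Finset.sum_fiberwise_of_maps_to (fun x hx => ?_) _).symm
        have := ht x hx
        exact Finset.mem_Icc.2 ⟨Nat.mul_pos this.2.1 (hs _ this.1).2.natDegree_pos, this.2.2⟩
    _ ≤ _ := by
        refine Finset.sum_le_sum fun k hk => ?_
        have hk0 : k ≠ 0 := by have := (Finset.mem_Icc.1 hk).1; omega
        calc _ = (∑ x ∈ t with x.2 * x.1.natDegree = k, x.1.natDegree) *
              (monicFinset (FactorsIn R) (d - k)).card := by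
              rw [Finset.sum_mul]
              refine Finset.sum_congr rfl fun x hx => ?_
              rw [(Finset.mem_filter.1 hx).2]
          _ = (∑ p ∈ {x ∈ t | x.2 * x.1.natDegree = k}.image Prod.fst, p.natDegree) *
              (monicFinset (FactorsIn R) (d - k)).card := by
              rw [Finset.sum_image]
              rintro ⟨p, e⟩ hx ⟨p', e'⟩ hx' (rfl : p = p')
              have h1 := Finset.mem_filter.1 hx
              have h2 := Finset.mem_filter.1 hx'
              have he : e = e' := Nat.eq_of_mul_eq_mul_right
                (hs p (ht _ h1.1).1).2.natDegree_pos (h1.2.trans h2.2.symm)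
              rw [he]
          _ ≤ _ := by
              refine Nat.mul_le_mul_right _ (sum_natDegree_irreducible_le hk0 _ fun p hp => ?_)
              obtain ⟨x, hx, rfl⟩ := Finset.mem_image.1 hp
              have h1 := Finset.mem_filter.1 hx
              have h2 := hs _ (ht x h1.1).1
              exact ⟨h2.1, h2.2, h1.2 ▸ dvd_mul_left _ _⟩

open Finset.HasAntidiagonal in
theorem sum_range_sum_antidiagonal (f : ℕ × ℕ → ℝ) (n : ℕ) :
    ∑ k ∈ Finset.range n, ∑ x ∈ antidiagonal k, f x =
      ∑ x ∈ (Finset.range n).biUnion antidiagonal, f x := by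
  refine (Finset.sum_biUnion fun i _ j _ hij => Finset.disjoint_left.2 fun x hxi hxj => hij ?_).symm
  rw [← mem_antidiagonal.1 hxi, mem_antidiagonal.1 hxj]

open Finset.HasAntidiagonal in
/-- A sequence dominated by the averages of its partial sums decays like `d ^ (-1 / 2)` as soon as
its convolution with a second sequence is bounded and the second one controls the first. -/
theorem le_six_div_sqrt_of_convolution_le {r r' σ : ℕ → ℝ} (hr : ∀ i, 0 ≤ r i)
    (hr' : ∀ i, 0 ≤ r' i) (hσ : ∀ i, 0 ≤ σ i) (hr0 : r 0 ≤ 1)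
    (hconv : ∀ k, ∑ x ∈ antidiagonal k, r x.1 * r' x.2 ≤ 1)
    (hle : ∀ k, r k ≤ ∑ x ∈ antidiagonal k, σ x.1 * r' x.2)
    (hsum : ∀ n, ∑ i ∈ Finset.range n, σ i ≤ 6)
    (hrec : ∀ d, d * r d ≤ ∑ i ∈ Finset.range d, r i) (d : ℕ) :
    r d ≤ 6 / √(d + 1) := by
  rcases Nat.eq_zero_or_pos d with rfl | hd
  · simp only [Nat.cast_zero, zero_add, Real.sqrt_one]
    linarith
  set T := ∑ i ∈ Finset.range d, r i
  set T' := ∑ i ∈ Finset.range d, r' i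
  have hT' : 0 ≤ T' := Finset.sum_nonneg fun i _ => hr' i
  have hT : 0 ≤ T := Finset.sum_nonneg fun i _ => hr i
  have h1 : T ≤ 6 * T' := calc
    T ≤ ∑ k ∈ Finset.range d, ∑ x ∈ antidiagonal k, σ x.1 * r' x.2 :=
        Finset.sum_le_sum fun k _ => hle k
    _ = ∑ x ∈ (Finset.range d).biUnion antidiagonal, σ x.1 * r' x.2 :=
        sum_range_sum_antidiagonal (fun x => σ x.1 * r' x.2) d
    _ ≤ ∑ x ∈ Finset.range d ×ˢ Finset.range d, σ x.1 * r' x.2 := by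
        refine Finset.sum_le_sum_of_subset_of_nonneg (fun x hx => ?_)
          fun x _ _ => mul_nonneg (hσ _) (hr' _)
        simp only [Finset.mem_biUnion, Finset.mem_range, mem_antidiagonal] at hx
        obtain ⟨k, hk, hx⟩ := hx
        simp only [Finset.mem_product, Finset.mem_range]
        omega
    _ = (∑ i ∈ Finset.range d, σ i) * T' := by
        rw [Finset.sum_mul_sum, Finset.sum_product]
    _ ≤ 6 * T' := mul_le_mul_of_nonneg_right (hsum d) hT'
  have h2 : T * T' ≤ 2 * d := calc
    T * T' = ∑ x ∈ Finset.range d ×ˢ Finset.range d, r x.1 * r' x.2 := by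
        rw [Finset.sum_mul_sum, Finset.sum_product]
    _ ≤ ∑ x ∈ (Finset.range (2 * d)).biUnion antidiagonal, r x.1 * r' x.2 := by
        refine Finset.sum_le_sum_of_subset_of_nonneg (fun x hx => ?_)
          fun x _ _ => mul_nonneg (hr _) (hr' _)
        simp only [Finset.mem_product, Finset.mem_range] at hx
        simp only [Finset.mem_biUnion, Finset.mem_range, mem_antidiagonal]
        exact ⟨_, by omega, rfl⟩
    _ = ∑ k ∈ Finset.range (2 * d), ∑ x ∈ antidiagonal k, r x.1 * r' x.2 :=
        (sum_range_sum_antidiagonal (fun x => r x.1 * r' x.2) _).symm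
    _ ≤ ∑ k ∈ Finset.range (2 * d), (1 : ℝ) := Finset.sum_le_sum fun k _ => hconv k
    _ = 2 * d := by simp
  have hd' : (1 : ℝ) ≤ d := by exact_mod_cast hd
  have h3 : (d * r d) ^ 2 ≤ 12 * d := calc
    (d * r d) ^ 2 ≤ T ^ 2 := pow_le_pow_left₀ (mul_nonneg (by positivity) (hr d)) (hrec d) 2
    _ ≤ 12 * d := by nlinarith
  have h4 : d * r d ^ 2 ≤ 12 := by
    refine le_of_mul_le_mul_left ?_ (show (0 : ℝ) < d by linarith)
    linarith
  rw [le_div_iff₀ (by positivity)]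
  refine abs_le_of_sq_le_sq' ?_ (by norm_num) |>.2
  rw [mul_pow, Real.sq_sqrt (by positivity)]
  nlinarith [sq_nonneg (r d)]

theorem sum_two_mul_half_pow_le (n : ℕ) :
    ∑ i ∈ Finset.range n, 2 * (1 / 2 : ℝ) ^ (i - i / 2) ≤ 6 := by
  have key : ∀ k : ℕ, ∑ i ∈ Finset.range (2 * k + 1), 2 * (1 / 2 : ℝ) ^ (i - i / 2) =
      6 - 4 * (1 / 2) ^ k := by
    intro k
    induction k with
    | zero => norm_num
    | succ k ih =>
      rw [show 2 * (k + 1) + 1 = 2 * k + 1 + 1 + 1 by ring, Finset.sum_range_succ,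
        Finset.sum_range_succ, ih, show 2 * k + 1 - (2 * k + 1) / 2 = k + 1 by omega,
        show 2 * k + 1 + 1 - (2 * k + 1 + 1) / 2 = k + 1 by omega]
      ring
  calc _ ≤ ∑ i ∈ Finset.range (2 * n + 1), 2 * (1 / 2 : ℝ) ^ (i - i / 2) :=
        Finset.sum_le_sum_of_subset_of_nonneg (Finset.range_mono (by omega))
          fun _ _ _ => by positivity
    _ ≤ 6 := by
        rw [key]
        have : (0 : ℝ) < (1 / 2) ^ n := by positivity
        linarith

theorem sum_card_isStarSymm_div_le [Fintype F] (n : ℕ) :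
    ∑ i ∈ Finset.range n, ((monicFinset (IsStarSymm (F := F)) i).card : ℝ) /
      (Fintype.card F : ℝ) ^ i ≤ 6 := by
  refine (Finset.sum_le_sum fun i _ => ?_).trans (sum_two_mul_half_pow_le n)
  have hq : (2 : ℝ) ≤ Fintype.card F := by exact_mod_cast Fintype.one_lt_card (α := F)
  have hpow : (Fintype.card F : ℝ) ^ i =
      (Fintype.card F : ℝ) ^ (i / 2) * (Fintype.card F : ℝ) ^ (i - i / 2) := by
    rw [← pow_add]
    congr 1
    omega
  have hcard : ((monicFinset (IsStarSymm (F := F)) i).card : ℝ) ≤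
      2 * (Fintype.card F : ℝ) ^ (i / 2) := by
    exact_mod_cast card_isStarSymm_le (F := F) i
  rw [div_le_iff₀ (by positivity), hpow]
  calc _ ≤ 2 * (Fintype.card F : ℝ) ^ (i / 2) * 1 := by rwa [mul_one]
    _ ≤ 2 * (Fintype.card F : ℝ) ^ (i / 2) *
        ((1 / 2 : ℝ) ^ (i - i / 2) * (Fintype.card F : ℝ) ^ (i - i / 2)) := by
        refine mul_le_mul_of_nonneg_left ?_ (by positivity)
        rw [← mul_pow]
        exact one_le_pow₀ (by linarith)
    _ = _ := by ring

open Finset.HasAntidiagonal in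
theorem card_factorsIn_isStarRep_le_div_sqrt [Fintype F] (d : ℕ) :
    ((monicFinset (FactorsIn (IsStarRep (F := F))) d).card : ℝ) ≤
      6 / √(d + 1) * (Fintype.card F : ℝ) ^ d := by
  have hq : (0 : ℝ) < Fintype.card F := by exact_mod_cast Fintype.card_pos (α := F)
  have hanti : ∀ k, ∀ x ∈ antidiagonal k,
      (Fintype.card F : ℝ) ^ x.1 * (Fintype.card F : ℝ) ^ x.2 = (Fintype.card F : ℝ) ^ k :=
    fun k x hx => by rw [← pow_add, mem_antidiagonal.1 hx]
  rw [← div_le_iff₀ (by positivity)]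
  refine le_six_div_sqrt_of_convolution_le
    (r := fun i => ((monicFinset (FactorsIn (IsStarRep (F := F))) i).card : ℝ) /
      (Fintype.card F : ℝ) ^ i)
    (r' := fun i => ((monicFinset (FactorsIn fun p : F[X] => ¬ IsStarRep p) i).card : ℝ) /
      (Fintype.card F : ℝ) ^ i)
    (σ := fun i => ((monicFinset (IsStarSymm (F := F)) i).card : ℝ) / (Fintype.card F : ℝ) ^ i)
    (fun i => by positivity) (fun i => by positivity) (fun i => by positivity) ?_ ?_ ?_
    sum_card_isStarSymm_div_le ?_ d
  · rw [div_le_one (by positivity)]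
    exact_mod_cast card_monicFinset_le _ 0
  · intro k
    simp only [div_mul_div_comm]
    rw [Finset.sum_congr rfl fun x hx => by rw [hanti k x hx], ← Finset.sum_div,
      div_le_one (by positivity)]
    exact_mod_cast sum_card_factorsIn_le (IsStarRep (F := F)) k
  · intro k
    simp only [div_mul_div_comm]
    rw [Finset.sum_congr rfl fun x hx => by rw [hanti k x hx], ← Finset.sum_div]
    refine div_le_div_of_nonneg_right ?_ (by positivity)
    exact_mod_cast card_factorsIn_isStarRep_le (F := F) k
  · intro d
    have h : ((d * (monicFinset (FactorsIn (IsStarRep (F := F))) d).card : ℕ) : ℝ) ≤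
        ((∑ k ∈ Finset.Icc 1 d, Fintype.card F ^ k *
          (monicFinset (FactorsIn (IsStarRep (F := F))) (d - k)).card : ℕ) : ℝ) := by
      exact_mod_cast mul_card_factorsIn_le (IsStarRep (F := F)) d
    push_cast at h
    rw [← mul_div_assoc, div_le_iff₀ (by positivity), Finset.sum_mul]
    refine h.trans (le_of_eq ?_)
    refine Finset.sum_bij' (fun k _ => d - k) (fun i _ => d - i) ?_ ?_ ?_ ?_ ?_
    · intro k hk
      rw [Finset.mem_Icc] at hk
      exact Finset.mem_range.2 (by omega)
    · intro i hi
      rw [Finset.mem_range] at hi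
      exact Finset.mem_Icc.2 (by omega)
    · intro k hk
      rw [Finset.mem_Icc] at hk
      omega
    · intro i hi
      rw [Finset.mem_range] at hi
      omega
    · intro k hk
      rw [Finset.mem_Icc] at hk
      have hpow : (Fintype.card F : ℝ) ^ d =
          (Fintype.card F : ℝ) ^ (d - k) * (Fintype.card F : ℝ) ^ k := by
        rw [← pow_add, Nat.sub_add_cancel hk.2]
      rw [hpow]
      field_simp

theorem card_factorsIn_mul_card_starSymm_le [Fintype F] {a : F} (ha : a * a = 1) {n j d : ℕ}
    (hn : 1 ≤ n) (hj : (j : ℝ) ≤ √n) (hd : j + 2 * d = n) :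
    ((monicFinset (FactorsIn (IsStarRep (F := F))) d).card : ℝ) *
        (monicFinset (fun f : F[X] => IsStarSymm f ∧ f.coeff 0 = a) j).card ≤
      12 / √n * (monicFinset (fun f : F[X] => IsStarSymm f ∧ f.coeff 0 = a) n).card := by
  have hs : 0 < √(n : ℝ) := Real.sqrt_pos.2 (by exact_mod_cast hn)
  have hsq : √(n : ℝ) ^ 2 = n := Real.sq_sqrt (by positivity)
  have hdn : √(n : ℝ) / 2 ≤ √((d : ℝ) + 1) := by
    refine Real.le_sqrt_of_sq_le ?_
    have : (j : ℝ) + 2 * d = n := by exact_mod_cast hd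
    nlinarith [sq_nonneg (√(n : ℝ) - 1)]
  have hdiv : 6 / √((d : ℝ) + 1) ≤ 12 / √n := by
    rw [div_le_div_iff₀ (by positivity) hs]
    linarith
  have hcard : ((monicFinset (fun f : F[X] => IsStarSymm f ∧ f.coeff 0 = a) j).card : ℝ) *
      (Fintype.card F : ℝ) ^ d ≤
        (monicFinset (fun f : F[X] => IsStarSymm f ∧ f.coeff 0 = a) n).card := by
    rw [← hd]
    exact_mod_cast card_starSymm_mul_pow_le ha j d
  calc _ ≤ 6 / √((d : ℝ) + 1) * (Fintype.card F : ℝ) ^ d *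
        (monicFinset (fun f : F[X] => IsStarSymm f ∧ f.coeff 0 = a) j).card :=
        mul_le_mul_of_nonneg_right (card_factorsIn_isStarRep_le_div_sqrt d) (by positivity)
    _ = 6 / √((d : ℝ) + 1) * ((monicFinset (fun f : F[X] => IsStarSymm f ∧ f.coeff 0 = a) j).card *
        (Fintype.card F : ℝ) ^ d) := by ring
    _ ≤ _ := mul_le_mul hdiv hcard (by positivity) (by positivity)

end Counting

/-- **Polynomials nearly factorizing as `g·g*`.**
The number of *-symmetric monic polynomials `f` of degree `n` over a finite field with `q`
elements, with constant coefficient `a = ±1`, which factor as `f = g·g*·h` with `g, h` monic,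
`g(0) ≠ 0`, and `deg h ≤ m ≤ n^{1/2}`, is `≤ C N (m+1)/n^{1/2}`, where `N` is the total number
of *-symmetric monic polynomials of degree `n` with constant coefficient `a`. -/
theorem stmt10 : ∃ C : ℝ, 0 < C ∧
    ∀ (F : Type) [Field F] [Fintype F], ∀ (q n m : ℕ) (a : F),
      Fintype.card F = q → 1 ≤ n → (m : ℝ) ≤ Real.sqrt n → (a = 1 ∨ a = -1) →
      ({f : F[X] | f.Monic ∧ IsStarSymm f ∧ f.natDegree = n ∧ f.coeff 0 = a ∧
          ∃ g h : F[X], g.Monic ∧ h.Monic ∧ g.coeff 0 ≠ 0 ∧ h.natDegree ≤ m ∧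
            f = g * starRev g * h}.ncard : ℝ) ≤
        C * ({f : F[X] | f.Monic ∧ IsStarSymm f ∧ f.natDegree = n ∧
              f.coeff 0 = a}.ncard : ℝ) * ((m : ℝ) + 1) / Real.sqrt n := by
  refine ⟨12, by norm_num, ?_⟩
  intro F _ _ q n m a _ hn hm ha
  classical
  have ha' : a * a = 1 := by rcases ha with rfl | rfl <;> simp
  let J : Finset ℕ := {j ∈ Finset.range (m + 1) | j + 2 * ((n - j) / 2) = n}
  let E : ℕ → Finset F[X] := fun j =>
    (monicFinset (FactorsIn IsStarRep) ((n - j) / 2) ×ˢ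
      monicFinset (fun f : F[X] => IsStarSymm f ∧ f.coeff 0 = a) j).image
        fun x => x.1 * starRev x.1 * x.2
  have hsub : {f : F[X] | f.Monic ∧ IsStarSymm f ∧ f.natDegree = n ∧ f.coeff 0 = a ∧
      ∃ g h : F[X], g.Monic ∧ h.Monic ∧ g.coeff 0 ≠ 0 ∧ h.natDegree ≤ m ∧
        f = g * starRev g * h} ⊆ (J.biUnion E : Finset F[X]) := by
    rintro f ⟨-, hs, hfn, hfa, g, h, hg, hh, hg0, hhm, rfl⟩
    obtain ⟨r, hr, hrd, hrR, hgr⟩ := exists_factorsIn_isStarRep g hg hg0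
    have hgm := monic_starRev hg0
    rw [(hg.mul hgm).natDegree_mul hh, hg.natDegree_mul hgm, natDegree_starRev hg0] at hfn
    rw [mul_coeff_zero, mul_coeff_zero, coeff_zero_starRev hg, mul_inv_cancel₀ hg0,
      one_mul] at hfa
    have hd : (n - h.natDegree) / 2 = g.natDegree := by omega
    refine Finset.mem_coe.2 (Finset.mem_biUnion.2 ⟨h.natDegree, ?_, ?_⟩)
    · rw [Finset.mem_filter, Finset.mem_range]
      omega
    · refine Finset.mem_image.2 ⟨(r, h), Finset.mem_product.2 ⟨?_, ?_⟩, ?_⟩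
      · exact mem_monicFinset.2 ⟨hr, hrd.trans hd.symm, hrR⟩
      · exact mem_monicFinset.2 ⟨hh, rfl, isStarSymm_of_mul_starRev hg hg0 hs, hfa⟩
      · rw [hgr]
  have htotal : {f : F[X] | f.Monic ∧ IsStarSymm f ∧ f.natDegree = n ∧ f.coeff 0 = a} =
      monicFinset (fun f : F[X] => IsStarSymm f ∧ f.coeff 0 = a) n := by
    ext f
    simp only [Set.mem_ofPred_eq, Finset.mem_coe, mem_monicFinset]
    tauto
  rw [htotal, Set.ncard_coe_finset]
  set N := (monicFinset (fun f : F[X] => IsStarSymm f ∧ f.coeff 0 = a) n).card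
  have hJ : J.card ≤ m + 1 := (Finset.card_filter_le _ _).trans (Finset.card_range _).le
  have hcard := (Set.ncard_le_ncard hsub (Finset.finite_toSet _)).trans
    ((Set.ncard_coe_finset _).le.trans (Finset.card_biUnion_le (s := J) (t := E)))
  calc _ ≤ ((∑ j ∈ J, (E j).card : ℕ) : ℝ) := by exact_mod_cast hcard
    _ = ∑ j ∈ J, ((E j).card : ℝ) := by push_cast; rfl
    _ ≤ ∑ j ∈ J, 12 / √n * N := by
        refine Finset.sum_le_sum fun j hj => ?_
        obtain ⟨hjm, hjn⟩ := Finset.mem_filter.1 hj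
        have hjm : j ≤ m := Nat.lt_succ_iff.1 (Finset.mem_range.1 hjm)
        refine le_trans ?_ (card_factorsIn_mul_card_starSymm_le ha' hn
          ((Nat.cast_le.2 hjm).trans hm) hjn)
        exact_mod_cast Finset.card_image_le.trans (Finset.card_product _ _).le
    _ = J.card * (12 / √n * N) := by rw [Finset.sum_const, nsmul_eq_mul]
    _ ≤ (m + 1) * (12 / √n * N) :=
        mul_le_mul_of_nonneg_right (by exact_mod_cast hJ) (by positivity)
    _ = 12 * N * (m + 1) / √n := by ring
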